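/- Let 2 ≤ r < s ≤ 3r+1 be integers and write s = pr + q with 0 ≤ q < r. Let t be the largest integer ℓ ≥ r+1 satisfying (ℓ/(ℓ−r))·(1 − 1/ℓ)^s > 1 if such an ℓ exists, and t = r otherwise. Then the inducibility of the Turán graph T(s,r) is i(T(s,r)) = t!·s! / ((t−r)!·(r−q)!·q!·(p!)^r·(p+1)^q·t^s). -/

import Mathlib

open Filter Topology

/-- The number of `|V(F)|`-element subsets of the vertex set of `G` that induce a
subgraph isomorphic to `F`. -/
noncomputable def inducedCount {α β : Type*} [Fintype α] [Fintype β]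
    (F : SimpleGraph α) (G : SimpleGraph β) : ℕ :=
  Set.ncard {s : Finset β | s.card = Fintype.card α ∧
    Nonempty (F ≃g SimpleGraph.induce (↑s : Set β) G)}

/-- The induced density `p(F,G) = P(F,G)/C(n,r)`. -/
noncomputable def inducedDensity {α β : Type*} [Fintype α] [Fintype β]
    (F : SimpleGraph α) (G : SimpleGraph β) : ℝ :=
  (inducedCount F G : ℝ) / ((Fintype.card β).choose (Fintype.card α))

/-- `i_k(F,n)`: the maximum induced density of `F` over `K_k`-free graphs on `n` vertices. -/
noncomputable def ikn {α : Type*} [Fintype α] (F : SimpleGraph α) (k n : ℕ) : ℝ :=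
  sSup {x : ℝ | ∃ G : SimpleGraph (Fin n), G.CliqueFree k ∧ x = inducedDensity F G}

/-- `i_k(F) = lim_{n → ∞} i_k(F,n)`. -/
noncomputable def ik {α : Type*} [Fintype α] (F : SimpleGraph α) (k : ℕ) : ℝ :=
  limUnder atTop (fun n => ikn F k n)

/-- A graph `F` is inducibility diverse if for every `k` there is `m > k`
with `i_k(F) < i_m(F)`. -/
def InducibilityDiverse {α : Type*} [Fintype α] (F : SimpleGraph α) : Prop :=
  ∀ k : ℕ, ∃ m : ℕ, k < m ∧ ik F k < ik F m

/-- `i(F,n)`: the maximum induced density of `F` over all graphs on `n` vertices. -/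
noncomputable def iN {α : Type*} [Fintype α] (F : SimpleGraph α) (n : ℕ) : ℝ :=
  sSup {x : ℝ | ∃ G : SimpleGraph (Fin n), x = inducedDensity F G}

/-- The inducibility `i(F) = lim_{n → ∞} i(F,n)`. -/
noncomputable def inducibility {α : Type*} [Fintype α] (F : SimpleGraph α) : ℝ :=
  limUnder atTop (fun n => iN F n)

/-- The ratio function `f(ℓ) = (ℓ/(ℓ-r))·(1 - 1/ℓ)^s`. -/
noncomputable def turanRatio (r s ℓ : ℕ) : ℝ :=
  ((ℓ : ℝ) / ((ℓ : ℝ) - (r : ℝ))) * (1 - 1 / (ℓ : ℝ)) ^ s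

/-- `g(ℓ) = ℓ!·s!/((ℓ-r)!·(r-q)!·q!·(p!)^r·(p+1)^q·ℓ^s)`, where `s = pr + q`. -/
noncomputable def gTuran (r s p q ℓ : ℕ) : ℝ :=
  ((ℓ.factorial * s.factorial : ℕ) : ℝ) /
    (((ℓ - r).factorial * (r - q).factorial * q.factorial *
        p.factorial ^ r * (p + 1) ^ q : ℕ) * (ℓ : ℝ) ^ s)

section Counting

open SimpleGraph

/-- Composing with an embedding of `F` into itself, the induced copies of `F` in `G` together with
the self-embeddings of `F` account for all embeddings of `F` into `G`. -/
theorem inducedCount_mul_card_selfEmbedding {α β : Type*} [Fintype α] [Fintype β]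
    (F : SimpleGraph α) (G : SimpleGraph β) :
    inducedCount F G * Nat.card (F ↪g F) = Nat.card (F ↪g G) := by
  classical
  let copies : Set (Finset β) := {s : Finset β | s.card = Fintype.card α ∧
    Nonempty (F ≃g SimpleGraph.induce (↑s : Set β) G)}
  let iso (S : copies) : F ≃g SimpleGraph.induce (↑S.1 : Set β) G := Classical.choice S.2.2
  let emb : copies × (F ↪g F) → (F ↪g G) := fun x =>
    (SimpleGraph.Embedding.induce (↑x.1.1 : Set β)).comp ((iso x.1).toEmbedding.comp x.2)
  have emb_apply (x : copies × (F ↪g F)) (a : α) : emb x a = (iso x.1 (x.2 a) : β) := rfl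
  have surj (e : F ↪g F) : Function.Surjective e :=
    Finite.injective_iff_surjective.mp e.injective
  have range_emb (x : copies × (F ↪g F)) : Set.range (emb x) = ↑x.1.1 := by
    ext b
    constructor
    · rintro ⟨a, rfl⟩
      exact (iso x.1 (x.2 a)).2
    · intro hb
      obtain ⟨c, hc⟩ := (iso x.1).surjective ⟨b, hb⟩
      obtain ⟨a, rfl⟩ := surj x.2 c
      exact ⟨a, by rw [emb_apply, hc]⟩
  have bij : Function.Bijective emb := by
    constructor
    · rintro ⟨S, e⟩ ⟨T, e'⟩ h
      have hST : S = T := by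
        apply Subtype.ext
        apply Finset.coe_injective
        rw [← range_emb (S, e), ← range_emb (T, e'), h]
      subst hST
      refine Prod.ext rfl (RelEmbedding.ext fun a => ?_)
      have := DFunLike.congr_fun h a
      rw [emb_apply, emb_apply] at this
      exact (iso S).injective (Subtype.ext this)
    · intro f
      let S : Finset β := Finset.univ.map f.toEmbedding
      have mem (a : α) : f a ∈ (↑S : Set β) := by simp [S]
      let g : α → (↑S : Set β) := fun a => ⟨f a, mem a⟩
      have hg : Function.Bijective g := by
        constructor
        · intro a b hab
          exact f.injective (congrArg Subtype.val hab)
        · rintro ⟨b, hb⟩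
          obtain ⟨a, -, ha⟩ := Finset.mem_map.mp (Finset.mem_coe.mp hb)
          exact ⟨a, Subtype.ext ha⟩
      let i : F ≃g SimpleGraph.induce (↑S : Set β) G :=
        ⟨Equiv.ofBijective g hg, fun {a b} => f.map_rel_iff⟩
      have hS : S ∈ copies := ⟨by simp [S], ⟨i⟩⟩
      refine ⟨(⟨S, hS⟩, (iso ⟨S, hS⟩).symm.toEmbedding.comp i.toEmbedding), ?_⟩
      ext a
      rw [emb_apply]
      change ((iso ⟨S, hS⟩) ((iso ⟨S, hS⟩).symm (i a)) : β) = f a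
      rw [RelIso.apply_symm_apply]
      rfl
  rw [← Nat.card_congr (Equiv.ofBijective emb bij), Nat.card_prod]
  rfl

/-- Embeddings of one complete multipartite graph into another, both given by their colour maps,
are counted by first choosing the image of every colour class. -/
theorem card_embedding_of_colorings {A B K C : Type*} [Fintype A] [Fintype B] [Fintype K]
    [Fintype C] [DecidableEq K] [DecidableEq C] {F : SimpleGraph A} {G : SimpleGraph B}
    {χ : A → K} {c : B → C} (hχ : Function.Surjective χ)
    (hF : ∀ i j, F.Adj i j ↔ χ i ≠ χ j) (hG : ∀ i j, G.Adj i j ↔ c i ≠ c j) :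
    Nat.card (F ↪g G) = ∑ σ : K ↪ C, ∏ k,
      (Fintype.card {b // c b = σ k}).descFactorial (Fintype.card {a // χ a = k}) := by
  classical
  let emb : (Σ σ : K ↪ C, ∀ k, {a // χ a = k} ↪ {b // c b = σ k}) → (F ↪g G) := fun x =>
    { toFun := fun a => x.2 (χ a) ⟨a, rfl⟩
      inj' := by
        intro a b hab
        beta_reduce at hab
        have hc : x.1 (χ a) = x.1 (χ b) := by
          rw [← (x.2 (χ a) ⟨a, rfl⟩).2, ← (x.2 (χ b) ⟨b, rfl⟩).2, hab]
        have hk := x.1.injective hc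
        have key : ∀ k (hk : χ a = k), (x.2 k ⟨a, hk⟩ : B) = x.2 (χ a) ⟨a, rfl⟩ := by
          rintro k rfl; rfl
        have h := (key _ hk).trans hab
        exact congrArg Subtype.val ((x.2 (χ b)).injective (Subtype.ext h))
      map_rel_iff' := by
        intro a b
        change G.Adj (x.2 (χ a) ⟨a, rfl⟩ : B) (x.2 (χ b) ⟨b, rfl⟩ : B) ↔ F.Adj a b
        rw [hF, hG, (x.2 (χ a) ⟨a, rfl⟩).2, (x.2 (χ b) ⟨b, rfl⟩).2, x.1.injective.ne_iff] }
  have emb_apply (x) (a : A) : emb x a = (x.2 (χ a) ⟨a, rfl⟩ : B) := rfl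
  have bij : Function.Bijective emb := by
    constructor
    · rintro ⟨σ, g⟩ ⟨τ, g'⟩ h
      have hστ : σ = τ := by
        ext k
        obtain ⟨a, rfl⟩ := hχ k
        rw [← (g (χ a) ⟨a, rfl⟩).2, ← (g' (χ a) ⟨a, rfl⟩).2]
        exact congrArg c (DFunLike.congr_fun h a)
      subst hστ
      congr 1
      funext k
      ext ⟨a, ha⟩
      subst ha
      exact DFunLike.congr_fun h a
    · intro f
      have key (a b : A) : c (f a) = c (f b) ↔ χ a = χ b := by
        rw [← not_iff_not, ← ne_eq, ← ne_eq, ← hG, ← hF, f.map_adj_iff]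
      let σ : K ↪ C := ⟨fun k => c (f (Function.surjInv hχ k)), fun k l h => by
        have := (key _ _).mp h
        rwa [Function.surjInv_eq hχ, Function.surjInv_eq hχ] at this⟩
      refine ⟨⟨σ, fun k => ⟨fun a => ⟨f a.1, ?_⟩, ?_⟩⟩, ?_⟩
      · refine (key _ _).mpr ?_
        rw [Function.surjInv_eq hχ, a.2]
      · intro a b hab
        exact Subtype.ext (f.injective (congrArg Subtype.val hab))
      · ext a
        rfl
  rw [← Nat.card_congr (Equiv.ofBijective emb bij), Nat.card_sigma]
  refine Finset.sum_congr rfl fun σ _ => ?_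
  rw [Nat.card_pi]
  exact Finset.prod_congr rfl fun k _ => by
    rw [Nat.card_eq_fintype_card, Fintype.card_embedding_eq]

/-- The self-embeddings of a complete multipartite graph. -/
theorem card_selfEmbedding_of_coloring {A K L : Type*} [Fintype A] [Fintype K] [DecidableEq K]
    [Fintype L] [DecidableEq L] {F : SimpleGraph A} {χ : A → K} (hχ : Function.Surjective χ)
    (hF : ∀ i j, F.Adj i j ↔ χ i ≠ χ j) {κ : K → L}
    (hκ : ∀ k l, κ k = κ l ↔ Fintype.card {a // χ a = k} = Fintype.card {a // χ a = l}) :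
    Nat.card (F ↪g F) = (∏ l, (Fintype.card {k // κ k = l}).factorial) *
      ∏ k, (Fintype.card {a // χ a = k}).factorial := by
  classical
  rw [card_embedding_of_colorings hχ hF hF,
    ← DomMulAct.stabilizer_card κ, ← Equiv.sum_comp (Equiv.embeddingEquivOfFinite K).symm]
  set m : K → ℕ := fun k => Fintype.card {a // χ a = k} with hm
  have term (g : Equiv.Perm K) : ∏ k, (m (g k)).descFactorial (m k) =
      if κ ∘ g = κ then ∏ k, (m k).factorial else 0 := by
    split_ifs with h
    · refine Finset.prod_congr rfl fun k _ => ?_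
      have : m (g k) = m k := (hκ _ _).mp (congrFun h k)
      rw [this, Nat.descFactorial_self]
    · by_contra hne
      rw [Finset.prod_eq_zero_iff] at hne
      push Not at hne
      have hle : ∀ k ∈ Finset.univ, m k ≤ m (g k) := fun k hk =>
        not_lt.mp fun hlt => hne k hk (Nat.descFactorial_of_lt hlt)
      have heq := (Finset.sum_eq_sum_iff_of_le hle).mp (Equiv.sum_comp g m).symm
      exact h (funext fun k => (hκ _ _).mpr (heq k (Finset.mem_univ k)).symm)
  calc _ = ∑ g : Equiv.Perm K, ∏ k, (m (g k)).descFactorial (m k) := rfl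
    _ = _ := by
      simp_rw [term]
      rw [← Finset.sum_filter, Finset.sum_const, smul_eq_mul, Fintype.card_subtype]

end Counting

section Weighted

/-- The map `φ` is an induced homomorphism into `G` from the complete multipartite graph with
colour map `χ`; it need not be injective on colour classes. -/
def RespectsColoring {A K V : Type*} (χ : A → K) (G : SimpleGraph V) (φ : A → V) : Prop :=
  ∀ i j, G.Adj (φ i) (φ j) ↔ χ i ≠ χ j

open Classical in
/-- The total weight of all induced homomorphisms, where vertices of `G` carry weights. -/
noncomputable def homWeight {A K V : Type*} [Fintype A] [Fintype V] (χ : A → K)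
    (G : SimpleGraph V) (w : V → ℝ) : ℝ :=
  ∑ φ : A → V, if RespectsColoring χ G φ then ∏ i, w (φ i) else 0

open Classical in
/-- The weight of all induced homomorphisms into a weighted clique, with `a k` the size of the
colour class `k`. -/
noncomputable def injWeight {K V : Type*} [Fintype K] [Fintype V] (a : K → ℕ) (w : V → ℝ) : ℝ :=
  ∑ σ : K ↪ V, ∏ k, w (σ k) ^ a k

open Classical in
/-- Move all the weight of `y` to `x`. -/
noncomputable def shiftWeight {V : Type*} (w : V → ℝ) (x y : V) : V → ℝ := fun v =>
  if v = x then w x + w y else if v = y then 0 else w v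

open Classical in
/-- Distribute the weight of `x` and `y` equally among them. -/
noncomputable def averageWeight {V : Type*} (w : V → ℝ) (x y : V) : V → ℝ := fun v =>
  if v = x ∨ v = y then (w x + w y) / 2 else w v

variable {A K V : Type*}

theorem shiftWeight_nonneg {w : V → ℝ} (hw : ∀ v, 0 ≤ w v) (x y v : V) :
    0 ≤ shiftWeight w x y v := by
  unfold shiftWeight
  split_ifs
  exacts [add_nonneg (hw x) (hw y), le_rfl, hw v]

theorem averageWeight_nonneg {w : V → ℝ} (hw : ∀ v, 0 ≤ w v) (x y v : V) :
    0 ≤ averageWeight w x y v := by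
  unfold averageWeight
  split_ifs
  exacts [div_nonneg (add_nonneg (hw x) (hw y)) zero_le_two, hw v]

theorem shiftWeight_mem_stdSimplex [Fintype V] {w : V → ℝ} (hw : w ∈ stdSimplex ℝ V) {x y : V}
    (hxy : x ≠ y) : shiftWeight w x y ∈ stdSimplex ℝ V := by
  classical
  refine ⟨shiftWeight_nonneg hw.1 x y, ?_⟩
  have h (v : V) : shiftWeight w x y v =
      w v + ((if v = x then w y else 0) - if v = y then w y else 0) := by
    unfold shiftWeight
    split_ifs <;> grind
  simp [h, Finset.sum_add_distrib, hw.2]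

theorem averageWeight_mem_stdSimplex [Fintype V] {w : V → ℝ} (hw : w ∈ stdSimplex ℝ V) {x y : V}
    (hxy : x ≠ y) : averageWeight w x y ∈ stdSimplex ℝ V := by
  classical
  refine ⟨averageWeight_nonneg hw.1 x y, ?_⟩
  have h (v : V) : averageWeight w x y v =
      w v + ((if v = x then (w y - w x) / 2 else 0) - if v = y then (w y - w x) / 2 else 0) := by
    unfold averageWeight
    split_ifs <;> grind
  simp [h, Finset.sum_add_distrib, hw.2]

/-- Symmetrization: for non-adjacent `x` and `y`, the total weight is convex along the segment that
moves weight between `x` and `y`. -/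
theorem add_mul_homWeight_le [Fintype A] [Fintype V] {χ : A → K} {G : SimpleGraph V} {w : V → ℝ}
    (hw : ∀ v, 0 ≤ w v) {x y : V} (hxy : x ≠ y) (hadj : ¬ G.Adj x y) :
    (w x + w y) * homWeight χ G w ≤
      w x * homWeight χ G (shiftWeight w x y) + w y * homWeight χ G (shiftWeight w y x) := by
  classical
  set w' := shiftWeight w x y with hw'
  let m : V → V := fun v => if v = y then x else v
  let τ := Equiv.swap x y
  have hw'0 : ∀ v, 0 ≤ w' v := shiftWeight_nonneg hw x y
  have hswap (v : V) : shiftWeight w y x (τ v) = w' v := by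
    simp only [hw', shiftWeight, τ, Equiv.swap_apply_def]
    split_ifs <;> grind
  have hflip : homWeight χ G (shiftWeight w y x) =
      ∑ ρ : A → V, if RespectsColoring χ G (τ ∘ ρ) then ∏ i, w' (ρ i) else 0 := by
    unfold homWeight
    rw [← Equiv.sum_comp ((Equiv.refl A).arrowCongr τ)]
    refine Finset.sum_congr rfl fun ρ _ => ?_
    have : ((Equiv.refl A).arrowCongr τ) ρ = τ ∘ ρ := rfl
    simp only [this, Function.comp_apply, hswap]
  have hfib : homWeight χ G w = ∑ ρ : A → V, ∑ φ : A → V with m ∘ φ = ρ,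
      if RespectsColoring χ G φ then ∏ i, w (φ i) else 0 :=
    (Finset.sum_fiberwise _ _ _).symm
  rw [hflip, hfib]
  unfold homWeight
  rw [Finset.mul_sum, Finset.mul_sum, Finset.mul_sum, ← Finset.sum_add_distrib]
  refine Finset.sum_le_sum fun ρ _ => ?_
  have hP : 0 ≤ ∏ i, w' (ρ i) := Finset.prod_nonneg fun i _ => hw'0 _
  have hterm (φ : A → V) : 0 ≤ (if RespectsColoring χ G φ then ∏ i, w (φ i) else 0) := by
    split_ifs
    exacts [Finset.prod_nonneg fun i _ => hw _, le_rfl]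
  have hrhs : 0 ≤ w x * (if RespectsColoring χ G ρ then ∏ i, w' (ρ i) else 0) +
      w y * (if RespectsColoring χ G (τ ∘ ρ) then ∏ i, w' (ρ i) else 0) := by
    have := hw x
    have := hw y
    split_ifs <;> positivity
  by_cases hy : ∃ i, ρ i = y
  · obtain ⟨i, hi⟩ := hy
    have : ∀ φ : A → V, m ∘ φ ≠ ρ := by
      rintro φ rfl
      simp only [Function.comp_apply, m] at hi
      grind
    rw [Finset.filter_false_of_mem fun φ _ => this φ, Finset.sum_empty, mul_zero]
    exact hrhs
  push Not at hy
  have hpure (φ : A → V) (hφ : m ∘ φ = ρ) (hv : RespectsColoring χ G φ) :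
      φ = ρ ∨ φ = τ ∘ ρ ∨ (RespectsColoring χ G ρ ∧ RespectsColoring χ G (τ ∘ ρ)) := by
    by_cases hx' : ∃ i, φ i = x
    · by_cases hy' : ∃ j, φ j = y
      · right; right
        obtain ⟨i₀, hi₀⟩ := hx'
        obtain ⟨j₀, hj₀⟩ := hy'
        have hcol (i : A) (hi : φ i = x ∨ φ i = y) : χ i = χ i₀ ∧ χ i = χ j₀ := by
          have h1 := hv i i₀
          have h2 := hv i j₀
          have h3 : ¬ G.Adj y x := fun h => hadj h.symm
          rcases hi with hi | hi <;> rw [hi, hi₀] at h1 <;> rw [hi, hj₀] at h2 <;>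
            simp_all
        have hsub (ι : A → A) (hι : ∀ i, χ (ι i) = χ i) : RespectsColoring χ G (φ ∘ ι) := by
          intro i j
          rw [Function.comp_apply, Function.comp_apply, hv, hι, hι]
        constructor
        · have : ρ = φ ∘ fun i => if φ i = y then i₀ else i := by
            subst hφ
            funext i
            simp only [Function.comp_apply, m]
            split_ifs <;> simp_all
          rw [this]
          refine hsub _ fun i => ?_
          split_ifs with h
          · exact (hcol i (Or.inr h)).1.symm
          · rfl
        · have : τ ∘ ρ = φ ∘ fun i => if φ i = x then j₀ else i := by
            subst hφ
            funext i
            simp only [Function.comp_apply, m, τ, Equiv.swap_apply_def]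
            split_ifs <;> simp_all
          rw [this]
          refine hsub _ fun i => ?_
          split_ifs with h
          · exact (hcol i (Or.inl h)).2.symm
          · rfl
      · left
        push Not at hy'
        subst hφ
        funext i
        simp [m, hy' i]
    · right; left
      push Not at hx'
      subst hφ
      funext i
      have := hx' i
      simp only [Function.comp_apply, m, τ, Equiv.swap_apply_def]
      split_ifs <;> simp_all
  by_cases hboth : RespectsColoring χ G ρ ∧ RespectsColoring χ G (τ ∘ ρ)
  · rw [if_pos hboth.1, if_pos hboth.2, ← add_mul]
    refine mul_le_mul_of_nonneg_left ?_ (add_nonneg (hw x) (hw y))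
    have hset : Finset.univ.filter (fun φ : A → V => m ∘ φ = ρ) =
        Fintype.piFinset fun i => Finset.univ.filter fun v => m v = ρ i := by
      ext φ
      simp [funext_iff]
    calc _ ≤ ∑ φ : A → V with m ∘ φ = ρ, ∏ i, w (φ i) := by
          refine Finset.sum_le_sum fun φ _ => ?_
          split_ifs
          exacts [le_rfl, Finset.prod_nonneg fun i _ => hw _]
      _ = ∏ i, ∑ v with m v = ρ i, w v := by rw [hset, Finset.prod_univ_sum]
      _ ≤ ∏ i, w' (ρ i) := by
          refine Finset.prod_le_prod (fun i _ => Finset.sum_nonneg fun v _ => hw v) fun i _ => ?_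
          by_cases hi : ρ i = x
          · have : Finset.univ.filter (fun v => m v = ρ i) = {x, y} := by
              ext v
              simp only [m, hi, Finset.mem_filter, Finset.mem_univ, true_and, Finset.mem_insert,
                Finset.mem_singleton]
              split_ifs <;> simp_all
            rw [this, Finset.sum_pair hxy, hw', shiftWeight, if_pos hi]
          · have : Finset.univ.filter (fun v => m v = ρ i) = {ρ i} := by
              ext v
              have := hy i
              simp only [m, Finset.mem_filter, Finset.mem_univ, true_and, Finset.mem_singleton]
              split_ifs <;> grind
            rw [this, Finset.sum_singleton, hw', shiftWeight, if_neg hi, if_neg (hy i)]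
  · have hx : (∃ i, ρ i = x) ∨
        ¬ (RespectsColoring χ G ρ ∨ RespectsColoring χ G (τ ∘ ρ)) := by
      by_contra! h
      have : τ ∘ ρ = ρ := funext fun i => Equiv.swap_apply_of_ne_of_ne (h.1 i) (hy i)
      rw [this] at h hboth
      tauto
    rcases hx with ⟨i, hi⟩ | hnone
    · have hle (u : V → V) (hu : u x = x ∨ u x = y) (hu' : ∀ v, v ≠ x → v ≠ y → u v = v) :
          (w x + w y) * ∏ i, w (u (ρ i)) ≤ w (u x) * ∏ i, w' (ρ i) := by
        rw [← Finset.mul_prod_erase _ _ (Finset.mem_univ i),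
          ← Finset.mul_prod_erase _ (fun i => w' (ρ i)) (Finset.mem_univ i), hi,
          show w' x = w x + w y by simp [hw', shiftWeight], mul_left_comm]
        refine mul_le_mul_of_nonneg_left (mul_le_mul_of_nonneg_left ?_
          (add_nonneg (hw x) (hw y))) (hw _)
        refine Finset.prod_le_prod (fun _ _ => hw _) fun j _ => ?_
        by_cases hj : ρ j = x
        · rw [hj, show w' x = w x + w y by simp [hw', shiftWeight]]
          have := hw x
          have := hw y
          rcases hu with h | h <;> rw [h] <;> linarith
        · rw [hu' _ hj (hy j), hw', shiftWeight, if_neg hj, if_neg (hy j)]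
      have hle₁ := hle id (Or.inl rfl) fun _ _ _ => rfl
      have hle₂ := hle τ (Or.inr (Equiv.swap_apply_left x y)) fun v h₁ h₂ =>
        Equiv.swap_apply_of_ne_of_ne h₁ h₂
      rw [show τ x = y from Equiv.swap_apply_left x y] at hle₂
      have hsum : (∑ φ : A → V with m ∘ φ = ρ,
          if RespectsColoring χ G φ then ∏ i, w (φ i) else 0) ≤
          (if RespectsColoring χ G ρ then ∏ i, w (ρ i) else 0) +
          (if RespectsColoring χ G (τ ∘ ρ) then ∏ i, w (τ (ρ i)) else 0) := by
        have hne : ρ ≠ τ ∘ ρ := fun h => by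
          have := congrFun h i
          rw [Function.comp_apply, hi, show τ x = y from Equiv.swap_apply_left x y] at this
          exact hxy this
        rw [← Finset.sum_filter_ne_zero]
        refine le_trans (Finset.sum_le_sum_of_subset_of_nonneg (t := {ρ, τ ∘ ρ}) ?_
          fun φ _ _ => hterm φ) (Finset.sum_pair hne).le
        intro φ hφ
        rw [Finset.mem_filter, Finset.mem_filter] at hφ
        obtain ⟨hφ, hne0⟩ := hφ
        have hv : RespectsColoring χ G φ := by
          by_contra h
          exact hne0 (if_neg h)
        rcases hpure φ hφ.2 hv with h | h | h
        · simp [h]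
        · simp [h]
        · exact absurd h hboth
      refine le_trans (mul_le_mul_of_nonneg_left hsum (add_nonneg (hw x) (hw y))) ?_
      rw [mul_add]
      refine add_le_add ?_ ?_
      · split_ifs
        exacts [hle₁, by simp]
      · split_ifs
        exacts [hle₂, by simp]
    · push Not at hnone
      rw [Finset.sum_eq_zero, mul_zero]
      · exact hrhs
      · intro φ hφ
        rw [Finset.mem_filter] at hφ
        refine if_neg fun hv => ?_
        rcases hpure φ hφ.2 hv with h | h | h
        · exact hnone.1 (h ▸ hv)
        · exact hnone.2 (h ▸ hv)
        · exact hboth h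

/-- The two-variable convexity inequality behind balancing two parts of a complete multipartite
graph. -/
theorem two_part_balancing {A B : ℝ} (hA : 0 ≤ A) (hB : 0 ≤ B) {p a b : ℕ} (hp : 1 ≤ p)
    (hp3 : p ≤ 3) (ha : a = 0 ∨ a = p ∨ a = p + 1) (hb : b = 0 ∨ b = p ∨ b = p + 1) :
    (A + B) ^ 2 * (A ^ a * B ^ b + B ^ a * A ^ b) ≤
      (A - B) ^ 2 * ((A + B) ^ a * 0 ^ b + 0 ^ a * (A + B) ^ b) +
        4 * (A * B) * (((A + B) / 2) ^ a * ((A + B) / 2) ^ b +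
          ((A + B) / 2) ^ a * ((A + B) / 2) ^ b) := by
  have h₁ : 0 ≤ A * B * (A + B) ^ 2 * (A - B) ^ 2 := by positivity
  have h₂ : 0 ≤ A * B * (A + B) ^ 3 * (A - B) ^ 2 := by positivity
  have h₃ : 0 ≤ A * B * (A + B) ^ 2 * (A - B) ^ 2 * ((A + B) ^ 2 + 4 * (A * B)) := by positivity
  have h₄ : 0 ≤ A * B * (A + B) ^ 3 * (A - B) ^ 2 * ((A + B) ^ 2 + 4 * (A * B)) := by positivity
  have h₅ : 0 ≤ A * B * (A + B) ^ 2 * (A - B) ^ 2 *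
      ((A + B) ^ 4 + 4 * (A * B) * (A + B) ^ 2 + 16 * (A * B) ^ 2) := by positivity
  interval_cases p <;> rcases ha with rfl | rfl | rfl <;> rcases hb with rfl | rfl | rfl <;>
    norm_num <;> linarith

theorem prod_pow_eq_pow_mul_pow_mul_prod {K V : Type*} [Fintype K] [DecidableEq V] (σ : K ↪ V) (a : K → ℕ)
    (w : V → ℝ) {x y : V} (hxy : x ≠ y) :
    ∏ k, w (σ k) ^ a k = w x ^ (∑ k, if σ k = x then a k else 0) *
      w y ^ (∑ k, if σ k = y then a k else 0) *
      ∏ k, if σ k = x ∨ σ k = y then 1 else w (σ k) ^ a k := by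
  rw [← Finset.prod_pow_eq_pow_sum, ← Finset.prod_pow_eq_pow_sum, ← Finset.prod_mul_distrib,
    ← Finset.prod_mul_distrib]
  refine Finset.prod_congr rfl fun k _ => ?_
  by_cases hx : σ k = x
  · simp [hx, hxy]
  · by_cases hy : σ k = y
    · simp [hy, hxy.symm]
    · simp [hx, hy]

theorem injWeight_add_self [Fintype K] [Fintype V] [DecidableEq V] (a : K → ℕ) (w : V → ℝ)
    {x y : V} (hxy : x ≠ y) :
    injWeight a w + injWeight a w = ∑ σ : K ↪ V,
      (w x ^ (∑ k, if σ k = x then a k else 0) * w y ^ (∑ k, if σ k = y then a k else 0) +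
        w y ^ (∑ k, if σ k = x then a k else 0) * w x ^ (∑ k, if σ k = y then a k else 0)) *
      ∏ k, if σ k = x ∨ σ k = y then 1 else w (σ k) ^ a k := by
  have h : injWeight a w = ∑ σ : K ↪ V, ∏ k, (w ∘ Equiv.swap x y) (σ k) ^ a k := by
    unfold injWeight
    rw [← Equiv.sum_comp ((Equiv.refl K).embeddingCongr (Equiv.swap x y))]
    exact Finset.sum_congr (by ext; simp) fun σ _ => rfl
  nth_rw 2 [h]
  unfold injWeight
  convert Finset.sum_add_distrib.symm.trans ?_ using 1
  refine Finset.sum_congr (by ext; simp) fun σ _ => ?_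
  rw [prod_pow_eq_pow_mul_pow_mul_prod σ a w hxy,
    prod_pow_eq_pow_mul_pow_mul_prod σ a (w ∘ Equiv.swap x y) hxy, add_mul]
  simp only [Function.comp_apply, Equiv.swap_apply_left, Equiv.swap_apply_right]
  congr 2
  refine Finset.prod_congr rfl fun k _ => ?_
  split_ifs with h
  · rfl
  · push Not at h
    rw [Equiv.swap_apply_of_ne_of_ne h.1 h.2]

/-- Balancing: the weight of a clique is convex in the product of two vertex weights when their sum
is kept fixed. -/
theorem sq_mul_injWeight_le [Fintype K] [Fintype V] {a : K → ℕ} {p : ℕ} (hp : 1 ≤ p) (hp3 : p ≤ 3)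
    (ha : ∀ k, a k = p ∨ a k = p + 1) {w : V → ℝ} (hw : ∀ v, 0 ≤ w v) {x y : V} (hxy : x ≠ y) :
    (w x + w y) ^ 2 * injWeight a w ≤ (w x - w y) ^ 2 * injWeight a (shiftWeight w x y) +
      4 * (w x * w y) * injWeight a (averageWeight w x y) := by
  classical
  suffices (w x + w y) ^ 2 * (injWeight a w + injWeight a w) ≤
      (w x - w y) ^ 2 * (injWeight a (shiftWeight w x y) + injWeight a (shiftWeight w x y)) +
      4 * (w x * w y) *
        (injWeight a (averageWeight w x y) + injWeight a (averageWeight w x y)) by linarith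
  rw [injWeight_add_self a _ hxy, injWeight_add_self a _ hxy, injWeight_add_self a _ hxy,
    Finset.mul_sum, Finset.mul_sum, Finset.mul_sum, ← Finset.sum_add_distrib]
  refine Finset.sum_le_sum fun σ _ => ?_
  have hexp (z : V) : (∑ k, if σ k = z then a k else 0) = 0 ∨
      (∑ k, if σ k = z then a k else 0) = p ∨ (∑ k, if σ k = z then a k else 0) = p + 1 := by
    by_cases hz : ∃ k, σ k = z
    · obtain ⟨k, rfl⟩ := hz
      right
      rw [Finset.sum_eq_single k (fun l _ hl => if_neg (σ.injective.ne hl)) (by simp), if_pos rfl]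
      exact ha k
    · left
      push Not at hz
      simp [hz]
  have hrest (u : V → ℝ) (hu : ∀ v, v ≠ x → v ≠ y → u v = w v) :
      (∏ k, if σ k = x ∨ σ k = y then 1 else u (σ k) ^ a k) =
        ∏ k, if σ k = x ∨ σ k = y then 1 else w (σ k) ^ a k := by
    refine Finset.prod_congr rfl fun k _ => ?_
    split_ifs with h
    · rfl
    · push Not at h
      rw [hu _ h.1 h.2]
  rw [hrest (shiftWeight w x y) fun v h₁ h₂ => by simp [shiftWeight, h₁, h₂],
    hrest (averageWeight w x y) fun v h₁ h₂ => by simp [averageWeight, h₁, h₂],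
    ← mul_assoc, ← mul_assoc, ← mul_assoc, ← add_mul]
  refine mul_le_mul_of_nonneg_right ?_ (Finset.prod_nonneg fun k _ => ?_)
  · rw [show shiftWeight w x y x = w x + w y by simp [shiftWeight],
      show shiftWeight w x y y = 0 by simp [shiftWeight, hxy.symm],
      show averageWeight w x y x = (w x + w y) / 2 by simp [averageWeight],
      show averageWeight w x y y = (w x + w y) / 2 by simp [averageWeight]]
    exact two_part_balancing (hw x) (hw y) hp hp3 (hexp x) (hexp y)
  · split_ifs
    exacts [zero_le_one, pow_nonneg (hw _) _]

theorem homWeight_eq_injWeight [Fintype A] [Fintype K] [DecidableEq K] [Fintype V] {χ : A → K}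
    (hχ : Function.Surjective χ) {G : SimpleGraph V} {w : V → ℝ}
    (hclique : ∀ x y, x ≠ y → w x ≠ 0 → w y ≠ 0 → G.Adj x y) :
    homWeight χ G w = injWeight (fun k => Fintype.card {i // χ i = k}) w := by
  classical
  symm
  unfold homWeight injWeight
  convert Fintype.sum_of_injective (fun (σ : K ↪ V) (i : A) => σ (χ i)) ?_ _ _ ?_ ?_ using 1
  · intro σ τ h
    ext k
    obtain ⟨i, rfl⟩ := hχ k
    exact congrFun h i
  · intro φ hφ
    rw [ite_eq_right_iff]
    intro hv
    by_contra hne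
    rw [Finset.prod_eq_zero_iff] at hne
    push Not at hne
    have key (i j : A) : φ i = φ j ↔ χ i = χ j := by
      rw [← not_iff_not, ← ne_eq (χ i), ← hv]
      exact ⟨fun h => hclique _ _ h (hne i (Finset.mem_univ i)) (hne j (Finset.mem_univ j)),
        fun h => h.ne⟩
    refine hφ ⟨⟨fun k => φ (Function.surjInv hχ k), fun k l h => ?_⟩, ?_⟩
    · have := (key _ _).mp h
      rwa [Function.surjInv_eq hχ, Function.surjInv_eq hχ] at this
    · funext i
      exact (key _ _).mpr (Function.surjInv_eq hχ _)
  · intro σ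
    have hprod : ∏ k, w (σ k) ^ Fintype.card {i // χ i = k} = ∏ i, w (σ (χ i)) := by
      rw [← Finset.prod_fiberwise Finset.univ χ]
      refine Finset.prod_congr rfl fun k _ => ?_
      rw [Finset.prod_congr rfl (g := fun _ => w (σ k)) fun i hi => by
        rw [(Finset.mem_filter.mp hi).2], Finset.prod_const, Fintype.card_subtype]
    rw [hprod]
    split_ifs with hv
    · rfl
    · by_contra hne
      rw [Finset.prod_eq_zero_iff] at hne
      push Not at hne
      refine hv fun i j => ?_
      constructor
      · intro h h'
        exact h.ne (congrArg σ h')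
      · intro h
        exact hclique _ _ (σ.injective.ne h) (hne i (Finset.mem_univ i)) (hne j (Finset.mem_univ j))

theorem continuous_homWeight [Fintype A] [Fintype V] (χ : A → K) (G : SimpleGraph V) :
    Continuous (homWeight χ G) := by
  unfold homWeight
  refine continuous_finsetSum _ fun φ _ => ?_
  split_ifs
  · fun_prop
  · fun_prop

theorem support_shiftWeight_ssubset {w : V → ℝ} {x y : V}
    (hxy : x ≠ y) (hx : w x ≠ 0) (hy : w y ≠ 0) :
    Function.support (shiftWeight w x y) ⊂ Function.support w := by
  refine ⟨fun v hv => ?_, fun h => ?_⟩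
  · rw [Function.mem_support] at hv ⊢
    unfold shiftWeight at hv
    split_ifs at hv with h₁ h₂
    · rwa [h₁]
    · exact absurd rfl hv
    · exact hv
  · have := h (Function.mem_support.mpr hy)
    simp [shiftWeight, hxy.symm] at this

/-- The weight of a clique whose vertices carry equal weights. -/
theorem injWeight_of_eq_inv_card [Fintype K] [Fintype V] [DecidableEq V] {a : K → ℕ}
    (ha : ∀ k, a k ≠ 0) {w : V → ℝ} {C : Finset V} (hC : ∀ v ∈ C, w v = (C.card : ℝ)⁻¹)
    (hC0 : ∀ v ∉ C, w v = 0) :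
    injWeight a w = (C.card.descFactorial (Fintype.card K) : ℝ) / (C.card : ℝ) ^ ∑ k, a k := by
  classical
  unfold injWeight
  rw [← Fintype.sum_of_injective
    (fun σ : K ↪ C => σ.trans (Function.Embedding.subtype (· ∈ C)))
    (fun σ τ h => by
      ext k
      exact DFunLike.congr_fun h k)
    (fun _ => ((C.card : ℝ) ^ ∑ k, a k)⁻¹)]
  · simp [div_eq_mul_inv]
  · intro σ hσ
    by_contra hne
    rw [Finset.prod_eq_zero_iff] at hne
    push Not at hne
    have hmem (k : K) : σ k ∈ C := by
      by_contra h
      refine hne k (Finset.mem_univ k) ?_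
      rw [hC0 _ h, zero_pow (ha k)]
    exact hσ ⟨⟨fun k => ⟨σ k, hmem k⟩, fun k l h => σ.injective (congrArg Subtype.val h)⟩, rfl⟩
  · intro σ
    rw [← inv_pow, ← Finset.prod_pow_eq_pow_sum]
    refine Finset.prod_congr rfl fun k _ => ?_
    rw [← hC _ (σ k).2]
    rfl

/-- On the simplex, the weight of the induced homomorphisms from a complete multipartite graph with
nearly equal small parts is maximized by the uniform weights on some clique. -/
theorem homWeight_le [Fintype A] [Fintype K] [DecidableEq K] [Fintype V] {χ : A → K}
    (hχ : Function.Surjective χ) {p : ℕ} (hp : 1 ≤ p) (hp3 : p ≤ 3)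
    (hsize : ∀ k, Fintype.card {i // χ i = k} = p ∨ Fintype.card {i // χ i = k} = p + 1)
    {M : ℝ} (hM : ∀ ℓ : ℕ, 1 ≤ ℓ →
      (ℓ.descFactorial (Fintype.card K) : ℝ) / (ℓ : ℝ) ^ Fintype.card A ≤ M)
    (G : SimpleGraph V) {w : V → ℝ} (hw : w ∈ stdSimplex ℝ V) : homWeight χ G w ≤ M := by
  classical
  obtain ⟨w₀, hw₀, hmax₀⟩ := (isCompact_stdSimplex ℝ V).exists_isMaxOn ⟨w, hw⟩
    (continuous_homWeight χ G).continuousOn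
  let S : Set (V → ℝ) := {u | u ∈ stdSimplex ℝ V ∧
    ∀ v ∈ stdSimplex ℝ V, homWeight χ G v ≤ homWeight χ G u}
  obtain ⟨u, ⟨hu, humax⟩, hmin⟩ := (measure fun u : V → ℝ => (Function.support u).ncard).wf.has_min
    S ⟨w₀, hw₀, fun v hv => hmax₀ hv⟩
  have hshift {x y : V} (hxy : x ≠ y) (hx : u x ≠ 0) (hy : u y ≠ 0) :
      homWeight χ G (shiftWeight u x y) < homWeight χ G u := by
    by_contra! h
    refine hmin _ ⟨shiftWeight_mem_stdSimplex hu hxy, fun v hv => (humax v hv).trans h⟩ ?_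
    exact Set.ncard_lt_ncard (support_shiftWeight_ssubset hxy hx hy)
  have hpos {x : V} (hx : u x ≠ 0) : 0 < u x := lt_of_le_of_ne (hu.1 x) hx.symm
  have hclique (x y : V) (hxy : x ≠ y) (hx : u x ≠ 0) (hy : u y ≠ 0) : G.Adj x y := by
    by_contra hadj
    have h := add_mul_homWeight_le (χ := χ) hu.1 hxy hadj
    have h₁ := mul_lt_mul_of_pos_left (hshift hxy hx hy) (hpos hx)
    have h₂ := mul_lt_mul_of_pos_left (hshift hxy.symm hy hx) (hpos hy)
    linarith
  have hinj (v : V → ℝ) (hv : Function.support v ⊆ Function.support u) :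
      homWeight χ G v = injWeight (fun k => Fintype.card {i // χ i = k}) v :=
    homWeight_eq_injWeight hχ fun x y hxy hx hy => hclique x y hxy (hv hx) (hv hy)
  have hequal (x y : V) (hx : u x ≠ 0) (hy : u y ≠ 0) : u x = u y := by
    by_contra hne
    have hxy : x ≠ y := fun h => hne (h ▸ rfl)
    have h := sq_mul_injWeight_le hp hp3 hsize hu.1 hxy
    have hsub : Function.support (averageWeight u x y) ⊆ Function.support u := by
      intro v hv
      by_contra h0
      rw [Function.mem_support, not_not] at h0
      have hvx : v ≠ x := fun h => hx (h ▸ h0)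
      have hvy : v ≠ y := fun h => hy (h ▸ h0)
      simp [averageWeight, hvx, hvy, h0] at hv
    rw [← hinj _ subset_rfl, ← hinj _ (support_shiftWeight_ssubset hxy hx hy).subset,
      ← hinj _ hsub] at h
    have h₁ := mul_lt_mul_of_pos_left (hshift hxy hx hy) (sq_pos_of_ne_zero (sub_ne_zero.mpr hne))
    have h₂ := mul_le_mul_of_nonneg_left (humax _ (averageWeight_mem_stdSimplex hu hxy))
      (mul_nonneg zero_le_four (mul_pos (hpos hx) (hpos hy)).le)
    nlinarith
  let C : Finset V := Finset.univ.filter fun v => u v ≠ 0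
  have hC0 (v : V) (hv : v ∉ C) : u v = 0 := by simpa [C] using hv
  have hsum : ∑ v ∈ C, u v = 1 := by
    rw [← hu.2]
    exact Finset.sum_filter_ne_zero _
  have hCne : C.Nonempty := by
    rw [Finset.nonempty_iff_ne_empty]
    intro h
    simp [h] at hsum
  have hC (v : V) (hv : v ∈ C) : u v = (C.card : ℝ)⁻¹ := by
    rw [Finset.sum_congr rfl (g := fun _ => u v) fun x hx =>
      hequal x v (Finset.mem_filter.mp hx).2 (Finset.mem_filter.mp hv).2,
      Finset.sum_const, nsmul_eq_mul] at hsum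
    exact eq_inv_of_mul_eq_one_right hsum
  have hcard : ∑ k, Fintype.card {i // χ i = k} = Fintype.card A := by
    rw [← Fintype.card_sigma]
    exact Fintype.card_congr (Equiv.sigmaFiberEquiv χ)
  calc homWeight χ G w ≤ homWeight χ G u := humax w hw
    _ = injWeight (fun k => Fintype.card {i // χ i = k}) u := hinj u subset_rfl
    _ = (C.card.descFactorial (Fintype.card K) : ℝ) / (C.card : ℝ) ^ Fintype.card A := by
      rw [injWeight_of_eq_inv_card (fun k => by have := hsize k; omega) hC hC0, hcard]
    _ ≤ M := hM _ hCne.card_pos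

/-- The resulting bound on the number of embeddings. -/
theorem card_embedding_le [Fintype A] [Fintype K] [DecidableEq K] [Fintype V] [Nonempty V]
    {χ : A → K} (hχ : Function.Surjective χ) {p : ℕ} (hp : 1 ≤ p) (hp3 : p ≤ 3)
    (hsize : ∀ k, Fintype.card {i // χ i = k} = p ∨ Fintype.card {i // χ i = k} = p + 1)
    {M : ℝ} (hM : ∀ ℓ : ℕ, 1 ≤ ℓ →
      (ℓ.descFactorial (Fintype.card K) : ℝ) / (ℓ : ℝ) ^ Fintype.card A ≤ M)
    {F : SimpleGraph A} (hF : ∀ i j, F.Adj i j ↔ χ i ≠ χ j) (G : SimpleGraph V) :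
    (Nat.card (F ↪g G) : ℝ) ≤ M * (Fintype.card V : ℝ) ^ Fintype.card A := by
  classical
  have hV : (0 : ℝ) < Fintype.card V := by exact_mod_cast Fintype.card_pos
  have h := homWeight_le hχ hp hp3 hsize hM G (w := fun _ => (Fintype.card V : ℝ)⁻¹)
    ⟨fun _ => by positivity, by simp⟩
  have hcount : homWeight χ G (fun _ => (Fintype.card V : ℝ)⁻¹) =
      Fintype.card {φ : A → V // RespectsColoring χ G φ} *
        ((Fintype.card V : ℝ) ^ Fintype.card A)⁻¹ := by
    unfold homWeight
    rw [← Finset.sum_filter, Finset.sum_const, nsmul_eq_mul, Fintype.card_subtype]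
    simp
  have hle : Nat.card (F ↪g G) ≤ Fintype.card {φ : A → V // RespectsColoring χ G φ} := by
    rw [← Nat.card_eq_fintype_card]
    refine Nat.card_le_card_of_injective
      (fun f : F ↪g G => ⟨f, fun i j => f.map_adj_iff.trans (hF i j)⟩) fun f g hfg => ?_
    exact DFunLike.coe_injective (congrArg Subtype.val hfg)
  rw [hcount, ← div_eq_mul_inv, div_le_iff₀ (by positivity)] at h
  exact le_trans (by exact_mod_cast hle) h

end Weighted

section TuranRatio

theorem turanRatio_succ_mul (r s : ℕ) {n : ℕ} (hn : 1 ≤ n) (hrn : r ≤ n) :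
    turanRatio r s (n + 1) * ((n.descFactorial r : ℝ) / (n : ℝ) ^ s) =
      ((n + 1).descFactorial r : ℝ) / ((n + 1 : ℕ) : ℝ) ^ s := by
  have hn0 : (0 : ℝ) < n := by exact_mod_cast hn
  have hrn' : (r : ℝ) ≤ n := by exact_mod_cast hrn
  have hsub : (0 : ℝ) < n + 1 - r := by linarith
  have h : ((n : ℝ) + 1 - r) * ((n + 1).descFactorial r : ℝ) = (n + 1) * n.descFactorial r := by
    have := Nat.succ_descFactorial n r
    rw [← Nat.cast_inj (R := ℝ)] at this
    push_cast [Nat.cast_sub (hrn.trans n.le_succ)] at this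
    exact this
  have h1 : 1 - 1 / ((n : ℝ) + 1) = n / (n + 1) := by field_simp; ring
  unfold turanRatio
  push_cast
  rw [h1, div_pow]
  field_simp
  linarith

theorem turanRatio_le_one_iff {r s ℓ : ℕ} (hℓ : r < ℓ) :
    turanRatio r s ℓ ≤ 1 ↔ (1 - 1 / (ℓ : ℝ)) ^ s ≤ 1 - r / ℓ := by
  have h0 : (0 : ℝ) < ℓ := by exact_mod_cast hℓ.pos
  have hsub : (0 : ℝ) < ℓ - r := sub_pos.mpr (by exact_mod_cast hℓ)
  have : (1 : ℝ) - r / ℓ = ((ℓ : ℝ) / (ℓ - r))⁻¹ := by field_simp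
  rw [turanRatio, this, ← one_div, le_div_iff₀' (by positivity)]

/-- Once the ratio drops to `1` or below, it stays there. -/
theorem turanRatio_le_one_of_le {r s ℓ m : ℕ} (hℓ : r < ℓ) (hℓm : ℓ ≤ m)
    (h : turanRatio r s ℓ ≤ 1) : turanRatio r s m ≤ 1 := by
  rw [turanRatio_le_one_iff hℓ] at h
  rw [turanRatio_le_one_iff (hℓ.trans_le hℓm)]
  have hℓ0 : (1 : ℝ) ≤ ℓ := by exact_mod_cast hℓ.pos
  have hm : (ℓ : ℝ) ≤ m := by exact_mod_cast hℓm
  have hm0 : (0 : ℝ) < m := by linarith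
  have hθ : (ℓ : ℝ) / m ≤ 1 := (div_le_one hm0).mpr hm
  have hinv : 1 / (ℓ : ℝ) ≤ 1 := (div_le_one (by linarith)).mpr hℓ0
  have hconv := (convexOn_pow (𝕜 := ℝ) s).2 (x := 1) (y := 1 - 1 / ℓ) (by simp)
    (by simpa using hinv) (sub_nonneg.mpr hθ) (by positivity : (0 : ℝ) ≤ ℓ / m) (by ring)
  simp only [smul_eq_mul, one_pow, mul_one] at hconv
  have e1 : 1 - (ℓ : ℝ) / m + ℓ / m * (1 - 1 / ℓ) = 1 - 1 / m := by field_simp; ring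
  have e2 : 1 - (ℓ : ℝ) / m + ℓ / m * (1 - r / ℓ) = 1 - r / m := by field_simp; ring
  rw [e1] at hconv
  rw [← e2]
  exact hconv.trans (by gcongr)

/-- The number of parts singled out by the ratio maximizes the weight of balanced cliques. -/
theorem descFactorial_div_pow_le {r s t : ℕ} (hr : 1 ≤ r)
    (ht : (r + 1 ≤ t ∧ 1 < turanRatio r s t ∧
            ∀ ℓ : ℕ, r + 1 ≤ ℓ → 1 < turanRatio r s ℓ → ℓ ≤ t) ∨
          (t = r ∧ ∀ ℓ : ℕ, r + 1 ≤ ℓ → ¬ 1 < turanRatio r s ℓ)) (ℓ : ℕ) :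
    (ℓ.descFactorial r : ℝ) / (ℓ : ℝ) ^ s ≤ (t.descFactorial r : ℝ) / (t : ℝ) ^ s := by
  have hrt : r ≤ t := by omega
  have hstep_ge (n : ℕ) (hn : t ≤ n) : turanRatio r s (n + 1) ≤ 1 := by
    by_contra! h
    rcases ht with ⟨-, -, hmax⟩ | ⟨-, hnone⟩
    · have := hmax (n + 1) (by omega) h
      omega
    · exact hnone (n + 1) (by omega) h
  have hstep_lt (n : ℕ) (hrn : r ≤ n) (hn : n < t) : 1 ≤ turanRatio r s (n + 1) := by
    by_contra! h
    rcases ht with ⟨-, hgt, -⟩ | ⟨htr, -⟩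
    · exact absurd (turanRatio_le_one_of_le (by omega) hn h.le) (not_le.mpr hgt)
    · omega
  rcases lt_or_ge ℓ r with hℓr | hℓr
  · rw [Nat.descFactorial_of_lt hℓr]
    simp only [Nat.cast_zero, zero_div]
    positivity
  rcases le_total t ℓ with htℓ | hℓt
  · induction ℓ, htℓ using Nat.le_induction with
    | base => exact le_rfl
    | succ n hn ih =>
      rw [← turanRatio_succ_mul r s (by omega) (by omega)]
      exact (mul_le_of_le_one_left (by positivity) (hstep_ge n hn)).trans (ih (by omega))
  · have (n : ℕ) (hn : ℓ ≤ n) : n ≤ t → (ℓ.descFactorial r : ℝ) / (ℓ : ℝ) ^ s ≤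
        (n.descFactorial r : ℝ) / (n : ℝ) ^ s := by
      induction n, hn using Nat.le_induction with
      | base => exact fun _ => le_rfl
      | succ n hn ih =>
        intro hnt
        rw [← turanRatio_succ_mul r s (by omega) (by omega)]
        exact (ih (by omega)).trans
          (le_mul_of_one_le_left (by positivity) (hstep_lt n (by omega) hnt))
    exact this t hℓt le_rfl

end TuranRatio

section TuranColoring

open SimpleGraph

/-- The colour classes of the Turán graph. -/
def turanColor (n : ℕ) {r : ℕ} (hr : 0 < r) (i : Fin n) : Fin r :=
  ⟨i % r, Nat.mod_lt _ hr⟩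

theorem turanGraph_adj_iff_turanColor {n r : ℕ} (hr : 0 < r) (i j : Fin n) :
    (turanGraph n r).Adj i j ↔ turanColor n hr i ≠ turanColor n hr j := by
  rw [turanGraph_adj, turanColor, turanColor, ne_eq, ne_eq, Fin.mk.injEq]

theorem turanColor_surjective {n r : ℕ} (hr : 0 < r) (hrn : r ≤ n) :
    Function.Surjective (turanColor n hr) := fun k =>
  ⟨⟨k, k.2.trans_le hrn⟩, Fin.ext (Nat.mod_eq_of_lt k.2)⟩

theorem card_turanColor_fiber {n r : ℕ} (hr : 0 < r) (k : Fin r) :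
    Fintype.card {i // turanColor n hr i = k} = n / r + if (k : ℕ) < n % r then 1 else 0 := by
  have h := Nat.count_modEq_card n hr (k : ℕ)
  rw [Nat.mod_eq_of_lt k.2, Nat.count_eq_card_filter_range] at h
  rw [← h, Fintype.card_subtype, ← Finset.card_map Fin.valEmbedding]
  congr 1
  ext i
  simp only [Finset.mem_map, Finset.mem_filter, Finset.mem_univ, true_and, Fin.valEmbedding_apply,
    Finset.mem_range, turanColor, Fin.ext_iff, Nat.ModEq, Nat.mod_eq_of_lt k.2]
  exact ⟨fun ⟨a, ha, hi⟩ => hi ▸ ⟨a.2, ha⟩, fun ⟨hi, hk⟩ => ⟨⟨i, hi⟩, hk, rfl⟩⟩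

theorem card_fin_val_lt {r q : ℕ} (hq : q ≤ r) :
    Fintype.card {k : Fin r // (k : ℕ) < q} = q := by
  rw [Fintype.card_subtype, Fin.card_filter_val_lt, min_eq_right hq]

theorem card_selfEmbedding_turanGraph {r s p q : ℕ} (hr : 0 < r) (hrs : r ≤ s)
    (hspq : s = p * r + q) (hq : q < r) :
    Nat.card (turanGraph s r ↪g turanGraph s r) =
      (r - q).factorial * q.factorial * p.factorial ^ r * (p + 1) ^ q := by
  have hdiv : s / r = p := by
    rw [hspq, mul_comm, Nat.mul_add_div hr, Nat.div_eq_of_lt hq, add_zero]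
  have hmod : s % r = q := by rw [hspq, mul_comm, Nat.mul_add_mod, Nat.mod_eq_of_lt hq]
  rw [card_selfEmbedding_of_coloring (turanColor_surjective hr hrs)
    (turanGraph_adj_iff_turanColor hr) (κ := fun k => decide ((k : ℕ) < q))]
  · simp only [card_turanColor_fiber, hdiv, hmod, Fintype.prod_bool, decide_eq_true_eq,
      decide_eq_false_iff_not]
    rw [Fintype.card_subtype_compl, card_fin_val_lt hq.le, Fintype.card_fin]
    have hfac (k : Fin r) : (p + if (k : ℕ) < q then 1 else 0).factorial =
        p.factorial * if (k : ℕ) < q then p + 1 else 1 := by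
      split_ifs
      · rw [Nat.factorial_succ, mul_comm]
      · simp
    simp only [hfac]
    rw [Finset.prod_mul_distrib, Finset.prod_const, ← Finset.prod_filter, Finset.prod_const,
      ← Fintype.card_subtype, card_fin_val_lt hq.le, Finset.card_univ, Fintype.card_fin]
    ring
  · intro k l
    simp only [card_turanColor_fiber, hmod, decide_eq_decide]
    split_ifs <;> grind

theorem le_card_embedding_turanGraph {r s t n : ℕ} (hr : 0 < r) (hrs : r ≤ s) (ht : 0 < t) :
    t.descFactorial r * ∏ k, (n / t).descFactorial (Fintype.card {i // turanColor s hr i = k}) ≤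
      Nat.card (turanGraph s r ↪g turanGraph n t) := by
  rw [card_embedding_of_colorings (turanColor_surjective hr hrs)
    (turanGraph_adj_iff_turanColor hr) (turanGraph_adj_iff_turanColor ht)]
  calc _ = ∑ _σ : Fin r ↪ Fin t,
        ∏ k, (n / t).descFactorial (Fintype.card {i // turanColor s hr i = k}) := by simp
    _ ≤ _ := by
      refine Finset.sum_le_sum fun σ _ => Finset.prod_le_prod' fun k _ => ?_
      rw [card_turanColor_fiber ht]
      exact Nat.descFactorial_le _ (Nat.le_add_right _ _)

end TuranColoring

section Limits

theorem tendsto_pow_div_choose (s : ℕ) :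
    Tendsto (fun n : ℕ => (n : ℝ) ^ s / (n.choose s : ℝ)) atTop (𝓝 s.factorial) := by
  have hne : ∀ᶠ n : ℕ in atTop, (n.choose s : ℝ) ≠ 0 := by
    filter_upwards [eventually_ge_atTop s] with n hn
    exact_mod_cast (Nat.choose_pos hn).ne'
  have h := ((Asymptotics.isEquivalent_iff_tendsto_one hne).mp
    (isEquivalent_choose s).symm).mul_const (s.factorial : ℝ)
  rw [one_mul] at h
  refine h.congr fun n => ?_
  simp only [Pi.div_apply]
  field_simp

theorem tendsto_descFactorial_div_pow {t : ℕ} (ht : 0 < t) (a : ℕ) :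
    Tendsto (fun n : ℕ => ((n / t).descFactorial a : ℝ) / (n : ℝ) ^ a) atTop
      (𝓝 (((t : ℝ) ^ a)⁻¹)) := by
  have hdiv : Tendsto (fun n : ℕ => n / t) atTop atTop := Nat.tendsto_div_const_atTop ht.ne'
  have hne : ∀ᶠ n : ℕ in atTop, (n : ℝ) ^ a ≠ 0 := by
    filter_upwards [eventually_ge_atTop 1] with n hn
    positivity
  have h1 := (Asymptotics.isEquivalent_iff_tendsto_one hne).mp (isEquivalent_descFactorial a)
  have h2 : Tendsto (fun n : ℕ => ((n / t : ℕ) : ℝ) / n) atTop (𝓝 (t : ℝ)⁻¹) := by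
    have h := (tendsto_nat_floor_mul_div_atTop (R := ℝ) (a := (t : ℝ)⁻¹)
      (by positivity)).comp tendsto_natCast_atTop_atTop
    refine h.congr fun n => ?_
    rw [Function.comp_apply, inv_mul_eq_div, Nat.floor_div_eq_div]
  have h := (h1.comp hdiv).mul (h2.pow a)
  rw [one_mul, inv_pow] at h
  refine h.congr' ?_
  filter_upwards [eventually_ge_atTop t] with n hn
  have : 0 < n / t := Nat.div_pos hn ht
  simp only [Function.comp_apply, Pi.div_apply, div_pow]
  field_simp

end Limits

/-- Inducibility of the Turán graph `T(s,r)` for `2 ≤ r < s ≤ 3r+1`, `s = pr+q`: with `t`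
the largest integer `ℓ ≥ r+1` with `(ℓ/(ℓ-r))(1-1/ℓ)^s > 1` (and `t = r` if no such `ℓ`
exists), `i(T(s,r)) = t!·s!/((t-r)!·(r-q)!·q!·(p!)^r·(p+1)^q·t^s)`. -/
theorem stmt11 {r s p q t : ℕ} (hr : 2 ≤ r) (hrs : r < s) (hs3 : s ≤ 3 * r + 1)
    (hspq : s = p * r + q) (hq : q < r)
    (ht : (r + 1 ≤ t ∧ 1 < turanRatio r s t ∧
            ∀ ℓ : ℕ, r + 1 ≤ ℓ → 1 < turanRatio r s ℓ → ℓ ≤ t) ∨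
          (t = r ∧ ∀ ℓ : ℕ, r + 1 ≤ ℓ → ¬ 1 < turanRatio r s ℓ)) :
    inducibility (SimpleGraph.turanGraph s r) = gTuran r s p q t := by
  have hr0 : 0 < r := by omega
  have hrt : r ≤ t := by omega
  have ht0 : 0 < t := by omega
  have hp : 1 ≤ p := by
    by_contra! h
    obtain rfl : p = 0 := by omega
    omega
  have hp3 : p ≤ 3 := by
    by_contra! h
    have := Nat.mul_le_mul_right r h
    omega
  have hdiv : s / r = p := by
    rw [hspq, mul_comm, Nat.mul_add_div hr0, Nat.div_eq_of_lt hq, add_zero]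
  set F := SimpleGraph.turanGraph s r
  let a (k : Fin r) : ℕ := Fintype.card {i // turanColor s hr0 i = k}
  let aut : ℕ := (r - q).factorial * q.factorial * p.factorial ^ r * (p + 1) ^ q
  have haut : Nat.card (F ↪g F) = aut := card_selfEmbedding_turanGraph hr0 hrs.le hspq hq
  have haut0 : (0 : ℝ) < aut := by
    have : 0 < aut := by positivity
    exact_mod_cast this
  have hsize (k : Fin r) : a k = p ∨ a k = p + 1 := by
    simp only [a, card_turanColor_fiber, hdiv]
    split_ifs <;> simp
  have hsum : ∑ k, a k = s := by
    rw [← Fintype.card_sigma, Fintype.card_congr (Equiv.sigmaFiberEquiv (turanColor s hr0)),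
      Fintype.card_fin]
  have hdensity {n : ℕ} (G : SimpleGraph (Fin n)) :
      inducedDensity F G = (Nat.card (F ↪g G) : ℝ) / aut / n.choose s := by
    rw [inducedDensity, ← inducedCount_mul_card_selfEmbedding, haut, Fintype.card_fin,
      Fintype.card_fin, Nat.cast_mul, mul_div_cancel_right₀ _ haut0.ne']
  let D : ℝ := (t.descFactorial r : ℝ) / (t : ℝ) ^ s
  have hupper {n : ℕ} (hn : 1 ≤ n) (G : SimpleGraph (Fin n)) :
      inducedDensity F G ≤ D / aut * ((n : ℝ) ^ s / n.choose s) := by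
    have : Nonempty (Fin n) := ⟨⟨0, hn⟩⟩
    have h := card_embedding_le (M := D) (turanColor_surjective hr0 hrs.le) hp hp3 hsize
      (fun ℓ _ => by
        rw [Fintype.card_fin, Fintype.card_fin]
        exact descFactorial_div_pow_le hr0 ht ℓ)
      (turanGraph_adj_iff_turanColor hr0) G
    rw [Fintype.card_fin, Fintype.card_fin] at h
    rw [hdensity]
    calc _ ≤ D * (n : ℝ) ^ s / aut / n.choose s := by gcongr
      _ = _ := by ring
  have hlimit : gTuran r s p q t = D / aut * s.factorial := by
    have hfac : ((t - r).factorial : ℝ) * t.descFactorial r = t.factorial := by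
      exact_mod_cast Nat.factorial_mul_descFactorial hrt
    have hden : ((t - r).factorial * (r - q).factorial * q.factorial * p.factorial ^ r *
        (p + 1) ^ q : ℕ) = (t - r).factorial * aut := by
      simp only [aut]
      ring
    have htr : ((t - r).factorial : ℝ) ≠ 0 := by positivity
    rw [gTuran, hden]
    push_cast
    rw [← hfac]
    simp only [D]
    field_simp
  rw [hlimit]
  refine Tendsto.limUnder_eq ?_
  have hbdd {n : ℕ} (hn : 1 ≤ n) : BddAbove {x : ℝ | ∃ G : SimpleGraph (Fin n),
      x = inducedDensity F G} :=
    ⟨_, by rintro _ ⟨G, rfl⟩; exact hupper hn G⟩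
  refine tendsto_of_tendsto_of_tendsto_of_le_of_le'
    (g := fun n : ℕ => (t.descFactorial r : ℝ) / aut *
      ((∏ k, ((n / t).descFactorial (a k) : ℝ) / (n : ℝ) ^ a k) * ((n : ℝ) ^ s / n.choose s)))
    (h := fun n : ℕ => D / aut * ((n : ℝ) ^ s / n.choose s)) ?_
    ((tendsto_pow_div_choose s).const_mul _) ?_ ?_
  · have h := ((tendsto_finsetProd Finset.univ fun k _ =>
      tendsto_descFactorial_div_pow ht0 (a k)).mul (tendsto_pow_div_choose s)).const_mul
      ((t.descFactorial r : ℝ) / aut)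
    convert h using 2
    rw [Finset.prod_inv_distrib, Finset.prod_pow_eq_pow_sum, hsum]
    simp only [D]
    ring
  · filter_upwards [eventually_ge_atTop 1] with n hn
    refine le_trans ?_ (le_csSup (hbdd hn) ⟨SimpleGraph.turanGraph n t, rfl⟩)
    rw [hdensity]
    have h : ((t.descFactorial r * ∏ k, (n / t).descFactorial (a k) : ℕ) : ℝ) ≤
        Nat.card (F ↪g SimpleGraph.turanGraph n t) := by
      exact_mod_cast le_card_embedding_turanGraph (n := n) hr0 hrs.le ht0
    have hn0 : (n : ℝ) ^ s ≠ 0 := by positivity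
    calc _ = ((t.descFactorial r * ∏ k, (n / t).descFactorial (a k) : ℕ) : ℝ) / aut /
          n.choose s := by
          rw [Finset.prod_div_distrib, Finset.prod_pow_eq_pow_sum, hsum]
          push_cast
          field_simp
      _ ≤ _ := by gcongr
  · filter_upwards [eventually_ge_atTop 1] with n hn
    refine csSup_le ⟨_, ⊥, rfl⟩ ?_
    rintro _ ⟨G, rfl⟩
    exact hupper hn G
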